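/- Let f : ℝ² → ℝ be defined by f(x₁,x₂) = x₁² + x₂² if x₁² + x₂² ≥ 3, and f(x₁,x₂) = x₁² + x₂²/100 otherwise. For every x₂ ∈ [−5, 5], the marginal mean f₂(x₂) = (1/10) ∫_{−5}^{5} f(x₁, x₂) dx₁ equals x₂² + 25/3 − (99/500) · x₂² · √(max(3 − x₂², 0)); in particular f₂(x₂) = x₂² + 25/3 for |x₂| ≥ √3. -/

import Mathlib

open MeasureTheory Real

/-- The paper's toy function. -/
noncomputable def toyF (x₁ x₂ : ℝ) : ℝ :=
  if 3 ≤ x₁ ^ 2 + x₂ ^ 2 then x₁ ^ 2 + x₂ ^ 2 else x₁ ^ 2 + x₂ ^ 2 / 100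

/-- The toy function is a paraboloid minus a constant on the chord of the disc at height `x₂`. -/
lemma toyF_eq_sub_indicator (x₁ x₂ : ℝ) :
    toyF x₁ x₂ = (x₁ ^ 2 + x₂ ^ 2) -
      (Set.Ioo (-√(max (3 - x₂ ^ 2) 0)) √(max (3 - x₂ ^ 2) 0)).indicator
        (fun _ => 99 / 100 * x₂ ^ 2) x₁ := by
  have hmem : x₁ ∈ Set.Ioo (-√(max (3 - x₂ ^ 2) 0)) √(max (3 - x₂ ^ 2) 0) ↔
      ¬ 3 ≤ x₁ ^ 2 + x₂ ^ 2 := by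
    rw [Set.mem_Ioo, ← abs_lt, Real.lt_sqrt (abs_nonneg _), sq_abs, lt_max_iff, not_le]
    constructor
    · rintro (h | h)
      · linarith
      · nlinarith [sq_nonneg x₁]
    · intro h
      left
      linarith
  by_cases h : 3 ≤ x₁ ^ 2 + x₂ ^ 2
  · rw [Set.indicator_of_notMem (fun hx => hmem.1 hx h), toyF, if_pos h, sub_zero]
  · rw [Set.indicator_of_mem (hmem.2 h), toyF, if_neg h]
    ring

/-- The integral over `[-a, a]` of a constant supported on a smaller centred interval. -/
lemma intervalIntegral_indicator_Ioo_const {a s : ℝ} (hs : 0 ≤ s) (hsa : s ≤ a) (c : ℝ) :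
    ∫ x in -a..a, (Set.Ioo (-s) s).indicator (fun _ => c) x = 2 * s * c := by
  have hsub : Set.Ioo (-s) s ⊆ Set.Ioc (-a) a := fun x hx =>
    ⟨by linarith [hx.1], by linarith [hx.2]⟩
  rw [intervalIntegral.integral_of_le (by linarith), setIntegral_indicator measurableSet_Ioo,
    Set.inter_eq_self_of_subset_right hsub, setIntegral_const, Real.volume_real_Ioo_of_le
      (by linarith), smul_eq_mul]
  ring

/-- The marginal mean of the toy function in its second variable. -/
lemma marginal_mean_toyF (x₂ : ℝ) :
    (1 / 10) * ∫ x₁ in (-5 : ℝ)..5, toyF x₁ x₂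
      = x₂ ^ 2 + 25 / 3 - (99 / 500) * x₂ ^ 2 * √(max (3 - x₂ ^ 2) 0) := by
  have hs : √(max (3 - x₂ ^ 2) 0) ≤ 5 := by
    rw [Real.sqrt_le_left (by norm_num)]
    exact max_le (by nlinarith [sq_nonneg x₂]) (by norm_num)
  simp_rw [toyF_eq_sub_indicator]
  rw [intervalIntegral.integral_sub (Continuous.intervalIntegrable (by fun_prop) _ _)
      ⟨intervalIntegrable_const.1.indicator measurableSet_Ioo,
        intervalIntegrable_const.2.indicator measurableSet_Ioo⟩,
    intervalIntegral_indicator_Ioo_const (Real.sqrt_nonneg _) hs,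
    intervalIntegral.integral_add (Continuous.intervalIntegrable (by fun_prop) _ _)
      intervalIntegrable_const, integral_pow, intervalIntegral.integral_const, smul_eq_mul]
  ring

theorem stmt_8 :
    (∀ x₂ ∈ Set.Icc (-5 : ℝ) 5,
      (1 / 10) * ∫ x₁ in (-5 : ℝ)..5, toyF x₁ x₂
        = x₂ ^ 2 + 25 / 3 - (99 / 500) * x₂ ^ 2 * Real.sqrt (max (3 - x₂ ^ 2) 0)) ∧
    (∀ x₂ ∈ Set.Icc (-5 : ℝ) 5, Real.sqrt 3 ≤ |x₂| →
      (1 / 10) * ∫ x₁ in (-5 : ℝ)..5, toyF x₁ x₂ = x₂ ^ 2 + 25 / 3) := by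
  refine ⟨fun x₂ _ => marginal_mean_toyF x₂, fun x₂ _ h => ?_⟩
  rw [Real.sqrt_le_left (abs_nonneg _), sq_abs] at h
  rw [marginal_mean_toyF, max_eq_right (by linarith), Real.sqrt_zero, mul_zero, sub_zero]
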